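/- arXiv:2206.07262 — 5 statements merged into one kernel-verified Lean document; each statement's English description precedes it below -/
import Mathlib

section
/- Let k', k, l', l be natural numbers. Index the standard basis of ℤ^{k'+k} as e_i for i ∈ {−k',…,−1} ∪ {1,…,k} and set e_0 := 0 ∈ ℤ^{k'+k}; index the standard basis of ℤ^{l'+l} as f_j for j ∈ {−l',…,−1} ∪ {1,…,l} and set f_0 := 0 ∈ ℤ^{l'+l}. Let 𝒢 = ({−k',…,0} × {−l',…,0}) ∪ ({0,…,k} × {0,…,l}) ⊆ ℤ × ℤ, partially ordered by the product order. Then for every element x of the submonoid ℕ^{k'+k} ⊕ ℕ^{l'+l} of ℤ^{k'+k} ⊕ ℤ^{l'+l} there exists a maximal chain c of 𝒢 such that x is an ℕ-linear combination of the vectors e_i ⊕ f_j with (i,j) ∈ c and (i,j) ≠ (0,0). -/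
/-- The vector `e_i ∈ ℤ^{k'+k}` for an index `i ∈ {-k',…,-1} ∪ {1,…,k}`, with the
convention `e_0 = 0`: for `i < 0` it is the standard basis vector at position `i + k'`,
and for `i > 0` it is the standard basis vector at position `k' + i - 1`. -/
def stdVec (k' k : ℕ) (i : ℤ) : Fin (k' + k) → ℤ := fun p =>
  if (i < 0 ∧ (p : ℤ) = i + k') ∨ (0 < i ∧ (p : ℤ) = k' + i - 1) then 1 else 0

/-- The grid `𝒢 = ({-k',…,0} × {-l',…,0}) ∪ ({0,…,k} × {0,…,l}) ⊆ ℤ × ℤ`. -/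
def grid (k' k l' l : ℕ) : Set (ℤ × ℤ) :=
  {ij | (-(k' : ℤ) ≤ ij.1 ∧ ij.1 ≤ 0 ∧ -(l' : ℤ) ≤ ij.2 ∧ ij.2 ≤ 0) ∨
        (0 ≤ ij.1 ∧ ij.1 ≤ (k : ℤ) ∧ 0 ≤ ij.2 ∧ ij.2 ≤ (l : ℤ))}

/-- The index in `{-m',…,-1} ∪ {1,…,m}` of the basis vector at position `p`. -/
def basisIndex (m' m : ℕ) (p : Fin (m' + m)) : ℤ :=
  if (p : ℕ) < m' then (p : ℤ) - m' else (p : ℤ) - m' + 1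

/-- The indices, together with `0`, of the positive coordinates of `u`. -/
def posIndices (m' m : ℕ) (u : Fin (m' + m) → ℤ) : Set ℤ :=
  insert 0 (basisIndex m' m '' {p | 0 < u p})

lemma stdVec_zero (m' m : ℕ) : stdVec m' m 0 = 0 := by
  ext p
  simp [stdVec]

lemma stdVec_basisIndex (m' m : ℕ) (p : Fin (m' + m)) :
    stdVec m' m (basisIndex m' m p) = Pi.single p 1 := by
  ext q
  rw [Pi.single_apply]
  unfold stdVec basisIndex
  refine if_congr ?_ rfl rfl
  rw [Fin.ext_iff]
  split_ifs <;> omega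

lemma basisIndex_ne_zero (m' m : ℕ) (p : Fin (m' + m)) : basisIndex m' m p ≠ 0 := by
  unfold basisIndex
  split_ifs <;> omega

section posIndices

variable {m' m : ℕ} {u : Fin (m' + m) → ℤ} {i : ℤ}

lemma zero_mem_posIndices : (0 : ℤ) ∈ posIndices m' m u := Set.mem_insert _ _

lemma posIndices_finite : (posIndices m' m u).Finite :=
  ((Set.toFinite _).image _).insert _

lemma mem_Icc_of_mem_posIndices (hi : i ∈ posIndices m' m u) : -(m' : ℤ) ≤ i ∧ i ≤ m := by
  rcases hi with rfl | ⟨p, -, rfl⟩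
  · omega
  · have := p.isLt
    unfold basisIndex
    split_ifs <;> omega

lemma eq_zero_of_posIndices_subset (hu : 0 ≤ u) (h : posIndices m' m u ⊆ {0}) : u = 0 := by
  ext p
  by_contra hp
  exact basisIndex_ne_zero m' m p
    (h (Set.mem_insert_of_mem _ ⟨p, lt_of_le_of_ne (hu p) (Ne.symm hp), rfl⟩))

lemma sub_stdVec_nonneg (hu : 0 ≤ u) (hi : i ∈ posIndices m' m u) : 0 ≤ u - stdVec m' m i := by
  rcases hi with rfl | ⟨p, hp, rfl⟩
  · simpa [stdVec_zero] using hu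
  · intro q
    have hq := hu q
    rcases eq_or_ne q p with rfl | hne
    · simpa [stdVec_basisIndex] using Int.add_one_le_of_lt hp
    · simpa [stdVec_basisIndex, hne] using hq

lemma stdVec_nonneg (i : ℤ) : 0 ≤ stdVec m' m i := by
  intro p
  unfold stdVec
  split_ifs <;> simp

lemma posIndices_sub_stdVec_subset (i : ℤ) :
    posIndices m' m (u - stdVec m' m i) ⊆ posIndices m' m u := by
  refine Set.insert_subset_insert (Set.image_mono fun p hp => ?_)
  have h₁ : 0 < u p - stdVec m' m i p := hp
  have h₂ : 0 ≤ stdVec m' m i p := stdVec_nonneg i p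
  exact (by omega : 0 < u p)

lemma one_le_sum_stdVec (hi : i ∈ posIndices m' m u) (h0 : i ≠ 0) :
    1 ≤ ∑ p, stdVec m' m i p := by
  rcases hi with rfl | ⟨p, -, rfl⟩
  · exact absurd rfl h0
  · simp [stdVec_basisIndex]

end posIndices

/-- A nonzero nonnegative vector admits a nonzero grid point, supported on its positive
coordinates, that is comparable with every point supported there. -/
lemma exists_comparable_grid_point {k' k l' l : ℕ} {u : Fin (k' + k) → ℤ}
    {v : Fin (l' + l) → ℤ} (hu : 0 ≤ u) (hv : 0 ≤ v) (hne : (u, v) ≠ 0) :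
    ∃ a ∈ posIndices k' k u ×ˢ posIndices l' l v, a ∈ grid k' k l' l ∧ a ≠ (0, 0) ∧
      ∀ b ∈ posIndices k' k u ×ˢ posIndices l' l v, a ≤ b ∨ b ≤ a := by
  obtain ⟨i, hi, hi_max⟩ := Set.exists_max_image _ id (posIndices_finite (u := u))
    ⟨0, zero_mem_posIndices⟩
  obtain ⟨j, hj, hj_max⟩ := Set.exists_max_image _ id (posIndices_finite (u := v))
    ⟨0, zero_mem_posIndices⟩
  obtain ⟨i', hi', hi_min⟩ := Set.exists_min_image _ id (posIndices_finite (u := u))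
    ⟨0, zero_mem_posIndices⟩
  obtain ⟨j', hj', hj_min⟩ := Set.exists_min_image _ id (posIndices_finite (u := v))
    ⟨0, zero_mem_posIndices⟩
  simp only [id] at hi_max hj_max hi_min hj_min
  by_cases hij : (i, j) = (0, 0)
  · refine ⟨(i', j'), ⟨hi', hj'⟩, Or.inl ?_, fun hij' => hne ?_,
      fun b hb => Or.inl ⟨hi_min _ hb.1, hj_min _ hb.2⟩⟩
    · exact ⟨(mem_Icc_of_mem_posIndices hi').1, hi_min _ zero_mem_posIndices,
        (mem_Icc_of_mem_posIndices hj').1, hj_min _ zero_mem_posIndices⟩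
    · obtain ⟨rfl, rfl⟩ := Prod.mk.inj hij
      obtain ⟨rfl, rfl⟩ := Prod.mk.inj hij'
      exact Prod.ext
        (eq_zero_of_posIndices_subset hu fun a ha => le_antisymm (hi_max a ha) (hi_min a ha))
        (eq_zero_of_posIndices_subset hv fun a ha => le_antisymm (hj_max a ha) (hj_min a ha))
  · exact ⟨(i, j), ⟨hi, hj⟩, Or.inr
      ⟨hi_max _ zero_mem_posIndices, (mem_Icc_of_mem_posIndices hi).2,
        hj_max _ zero_mem_posIndices, (mem_Icc_of_mem_posIndices hj).2⟩, hij,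
      fun b hb => Or.inr ⟨hi_max _ hb.1, hj_max _ hb.2⟩⟩

/-- A nonnegative vector is an `ℕ`-linear combination of the vectors attached to a chain of
the grid supported on its positive coordinates. -/
lemma exists_chain_mem_closure {k' k l' l : ℕ} (u : Fin (k' + k) → ℤ)
    (v : Fin (l' + l) → ℤ) (hu : 0 ≤ u) (hv : 0 ≤ v) :
    ∃ c : Set (ℤ × ℤ), c ⊆ grid k' k l' l ∧ IsChain (· ≤ ·) c ∧
      c ⊆ posIndices k' k u ×ˢ posIndices l' l v ∧
      (u, v) ∈ AddSubmonoid.closure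
        {w : (Fin (k' + k) → ℤ) × (Fin (l' + l) → ℤ) |
          ∃ ij ∈ c, ij ≠ (0, 0) ∧ w = (stdVec k' k ij.1, stdVec l' l ij.2)} := by
  induction hn : (∑ p, u p + ∑ q, v q).toNat using Nat.strong_induction_on
    generalizing u v with
  | _ n ih =>
  by_cases h0 : (u, v) = 0
  · exact ⟨∅, Set.empty_subset _, IsChain.empty, Set.empty_subset _, h0 ▸ zero_mem _⟩
  obtain ⟨⟨i, j⟩, ⟨hi, hj⟩, hgrid, hij, hcomp⟩ := exists_comparable_grid_point hu hv h0
  dsimp only at hi hj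
  have hu' := sub_stdVec_nonneg hu hi
  have hv' := sub_stdVec_nonneg hv hj
  have hlt : (∑ p, (u - stdVec k' k i) p + ∑ q, (v - stdVec l' l j) q).toNat < n := by
    have hsu : 0 ≤ ∑ p, (u - stdVec k' k i) p := Finset.sum_nonneg fun p _ => hu' p
    have hsv : 0 ≤ ∑ q, (v - stdVec l' l j) q := Finset.sum_nonneg fun q _ => hv' q
    have hsi : 0 ≤ ∑ p, stdVec k' k i p := Finset.sum_nonneg fun p _ => stdVec_nonneg i p
    have hsj : 0 ≤ ∑ q, stdVec l' l j q := Finset.sum_nonneg fun q _ => stdVec_nonneg j q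
    have hpos : 1 ≤ ∑ p, stdVec k' k i p + ∑ q, stdVec l' l j q := by
      by_cases hi0 : i = 0
      · have := one_le_sum_stdVec hj fun hj0 => hij (by rw [hi0, hj0])
        omega
      · have := one_le_sum_stdVec hi hi0
        omega
    simp only [Pi.sub_apply, Finset.sum_sub_distrib] at hsu hsv ⊢
    omega
  obtain ⟨c, hcg, hc, hcs, hmem⟩ := ih _ hlt _ _ hu' hv' rfl
  have hcs' : c ⊆ posIndices k' k u ×ˢ posIndices l' l v := hcs.trans
    (Set.prod_mono (posIndices_sub_stdVec_subset i) (posIndices_sub_stdVec_subset j))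
  refine ⟨insert (i, j) c, Set.insert_subset hgrid hcg,
    hc.insert fun b hb _ => hcomp b (hcs' hb), Set.insert_subset ⟨hi, hj⟩ hcs', ?_⟩
  have hsplit : (u, v) =
      (u - stdVec k' k i, v - stdVec l' l j) + (stdVec k' k i, stdVec l' l j) := by simp
  rw [hsplit]
  refine add_mem (AddSubmonoid.closure_mono ?_ hmem)
    (AddSubmonoid.subset_closure ⟨(i, j), Set.mem_insert _ _, hij, rfl⟩)
  rintro w ⟨a, ha, h⟩
  exact ⟨a, Set.mem_insert_of_mem _ ha, h⟩

/-- Every chain in a set `s` extends to a maximal chain in `s`. -/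
lemma IsChain.exists_maximal_superset_within {α : Type*} [LE α] {s d : Set α}
    (hds : d ⊆ s) (hd : IsChain (· ≤ ·) d) :
    ∃ c, d ⊆ c ∧ Maximal (fun c => c ⊆ s ∧ IsChain (· ≤ ·) c) c := by
  refine zorn_subset_nonempty {c | c ⊆ s ∧ IsChain (· ≤ ·) c} (fun C hC hchain _ => ?_) d
    ⟨hds, hd⟩
  refine ⟨⋃₀ C, ⟨Set.sUnion_subset fun t ht => (hC ht).1, ?_⟩,
    fun t ht => Set.subset_sUnion_of_mem ht⟩
  rintro a ⟨t, ht, hat⟩ b ⟨t', ht', hbt⟩ hab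
  rcases hchain.total ht ht' with h | h
  · exact (hC ht').2 (h hat) hbt hab
  · exact (hC ht).2 hat (h hbt) hab

/-- Every element of the submonoid `ℕ^{k'+k} ⊕ ℕ^{l'+l}` of `ℤ^{k'+k} ⊕ ℤ^{l'+l}` is an
`ℕ`-linear combination of the vectors `e_i ⊕ f_j` with `(i,j)` ranging over a maximal
chain of the grid `𝒢` (excluding `(0,0)`, which gives the zero vector). -/
theorem stmt0 (k' k l' l : ℕ)
    (x : (Fin (k' + k) → ℤ) × (Fin (l' + l) → ℤ))
    (hx₁ : ∀ p, 0 ≤ x.1 p) (hx₂ : ∀ q, 0 ≤ x.2 q) :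
    ∃ c : Set (ℤ × ℤ), c ⊆ grid k' k l' l ∧ IsChain (· ≤ ·) c ∧
      (∀ c' : Set (ℤ × ℤ), c' ⊆ grid k' k l' l → IsChain (· ≤ ·) c' → c ⊆ c' → c' = c) ∧
      x ∈ AddSubmonoid.closure
        {v : (Fin (k' + k) → ℤ) × (Fin (l' + l) → ℤ) |
          ∃ ij ∈ c, ij ≠ (0, 0) ∧ v = (stdVec k' k ij.1, stdVec l' l ij.2)} := by
  obtain ⟨d, hdg, hd, -, hmem⟩ := exists_chain_mem_closure x.1 x.2 hx₁ hx₂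
  obtain ⟨c, hdc, hc⟩ := IsChain.exists_maximal_superset_within hdg hd
  refine ⟨c, hc.prop.1, hc.prop.2,
    fun c' hcg hc' hcc => (hc.eq_of_subset ⟨hcg, hc'⟩ hcc).symm,
    AddSubmonoid.closure_mono ?_ hmem⟩
  rintro w ⟨a, ha, h⟩
  exact ⟨a, hdc ha, h⟩
end

section
/- Let k, l ∈ ℕ and let c and c' be two monotone lattice paths from (0,0) to (k,l) in {0,…,k} × {0,…,l}. For a path c, let N_c ⊆ ℕ^k ⊕ ℕ^l denote the submonoid generated by the vectors e_i ⊕ f_j for (i,j) a point of c with (i,j) ≠ (0,0) (conventions e₀ = 0, f₀ = 0). Then N_c ∩ N_{c'} equals the submonoid generated by the vectors e_i ⊕ f_j over the common points (i,j) ≠ (0,0) of c and c'; that is, any two submonoids of the staircase refinement meet along the face generated by their common generators. -/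
/-- `stdE k i : ℤ^k` is the `i`-th standard basis vector for `1 ≤ i ≤ k`
(at position `i - 1`), with the convention `stdE k 0 = 0`. -/
def stdE (k i : ℕ) : Fin k → ℤ := fun p => if (p : ℕ) + 1 = i then 1 else 0

/-- `p` is a monotone lattice path from `(0,0)` to `(k,l)` in `{0,…,k} × {0,…,l}`:
each step increases exactly one coordinate by `1`. -/
def IsLatticePath (k l : ℕ) (p : Fin (k + l + 1) → ℕ × ℕ) : Prop :=
  p 0 = (0, 0) ∧ p (Fin.last (k + l)) = (k, l) ∧
  (∀ t, (p t).1 ≤ k ∧ (p t).2 ≤ l) ∧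
  ∀ t : Fin (k + l), p t.succ = ((p t.castSucc).1 + 1, (p t.castSucc).2) ∨
    p t.succ = ((p t.castSucc).1, (p t.castSucc).2 + 1)

/-- The submonoid `N_c ⊆ ℕ^k ⊕ ℕ^l` generated by the vectors `e_i ⊕ f_j` over the
points `(i,j) ≠ (0,0)` of a lattice path `c`. -/
def pathMonoid (k l : ℕ) (c : Fin (k + l + 1) → ℕ × ℕ) :
    AddSubmonoid ((Fin k → ℤ) × (Fin l → ℤ)) :=
  AddSubmonoid.closure
    {v | ∃ t : Fin (k + l + 1), c t ≠ (0, 0) ∧ v = (stdE k (c t).1, stdE l (c t).2)}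

/-- The vector `e_i ⊕ f_j` of a grid point `(i,j)`. -/
def gridVec (k l : ℕ) (p : ℕ × ℕ) : (Fin k → ℤ) × (Fin l → ℤ) := (stdE k p.1, stdE l p.2)

lemma IsLatticePath.monotone {k l : ℕ} {c : Fin (k + l + 1) → ℕ × ℕ}
    (hc : IsLatticePath k l c) : Monotone c := by
  refine Fin.monotone_iff_le_succ.2 fun t => ?_
  rcases hc.2.2.2 t with h | h <;> rw [h] <;> simp [Prod.le_def]

lemma sum_gridVec_fst (k l : ℕ) (m : Multiset (ℕ × ℕ)) (x : Fin k) :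
    (m.map (gridVec k l)).sum.1 x = m.countP (fun q => (x : ℕ) + 1 = q.1) := by
  induction m using Multiset.induction_on with
  | empty => simp
  | cons a m ih =>
    simp only [Multiset.map_cons, Multiset.sum_cons, Prod.fst_add, Pi.add_apply, ih,
      Multiset.countP_cons, gridVec, stdE]
    split_ifs <;> push_cast <;> ring

lemma sum_gridVec_snd (k l : ℕ) (m : Multiset (ℕ × ℕ)) (x : Fin l) :
    (m.map (gridVec k l)).sum.2 x = m.countP (fun q => (x : ℕ) + 1 = q.2) := by
  induction m using Multiset.induction_on with
  | empty => simp
  | cons a m ih =>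
    simp only [Multiset.map_cons, Multiset.sum_cons, Prod.snd_add, Pi.add_apply, ih,
      Multiset.countP_cons, gridVec, stdE]
    split_ifs <;> push_cast <;> ring

lemma exists_fst_eq_of_sum_gridVec_eq {k l : ℕ} {m m' : Multiset (ℕ × ℕ)}
    (h : (m.map (gridVec k l)).sum = (m'.map (gridVec k l)).sum) {p : ℕ × ℕ} (hp : p ∈ m)
    (h0 : p.1 ≠ 0) (hk : p.1 ≤ k) : ∃ q ∈ m', q.1 = p.1 := by
  have hx := congrFun (congrArg Prod.fst h) ⟨p.1 - 1, by omega⟩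
  rw [sum_gridVec_fst, sum_gridVec_fst, Nat.cast_inj] at hx
  obtain ⟨q, hq, hqp⟩ := Multiset.countP_pos.1
    (hx ▸ Multiset.countP_pos.2 ⟨p, hp, Nat.sub_add_cancel (Nat.pos_of_ne_zero h0)⟩)
  exact ⟨q, hq, by simp only at hqp; omega⟩

lemma exists_snd_eq_of_sum_gridVec_eq {k l : ℕ} {m m' : Multiset (ℕ × ℕ)}
    (h : (m.map (gridVec k l)).sum = (m'.map (gridVec k l)).sum) {p : ℕ × ℕ} (hp : p ∈ m)
    (h0 : p.2 ≠ 0) (hl : p.2 ≤ l) : ∃ q ∈ m', q.2 = p.2 := by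
  have hx := congrFun (congrArg Prod.snd h) ⟨p.2 - 1, by omega⟩
  rw [sum_gridVec_snd, sum_gridVec_snd, Nat.cast_inj] at hx
  obtain ⟨q, hq, hqp⟩ := Multiset.countP_pos.1
    (hx ▸ Multiset.countP_pos.2 ⟨p, hp, Nat.sub_add_cancel (Nat.pos_of_ne_zero h0)⟩)
  exact ⟨q, hq, by simp only at hqp; omega⟩

/-- The greatest point of a multiset is bounded by any upper bound of a multiset with the same
vector sum. -/
lemma le_of_sum_gridVec_eq {k l : ℕ} {m m' : Multiset (ℕ × ℕ)}
    (h : (m.map (gridVec k l)).sum = (m'.map (gridVec k l)).sum) {p q : ℕ × ℕ} (hp : p ∈ m)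
    (hpk : p ≤ (k, l)) (hq : ∀ r ∈ m', r ≤ q) : p ≤ q := by
  refine Prod.le_def.2 ⟨?_, ?_⟩
  · by_cases h0 : p.1 = 0
    · omega
    · obtain ⟨r, hr, e⟩ := exists_fst_eq_of_sum_gridVec_eq h hp h0 hpk.1
      exact e ▸ (hq r hr).1
  · by_cases h0 : p.2 = 0
    · omega
    · obtain ⟨r, hr, e⟩ := exists_snd_eq_of_sum_gridVec_eq h hp h0 hpk.2
      exact e ▸ (hq r hr).2

lemma IsChain.exists_multiset_greatest {α : Type*} [PartialOrder α] {s : Set α}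
    (hs : IsChain (· ≤ ·) s) {m : Multiset α} (hm : ∀ p ∈ m, p ∈ s) (h0 : m ≠ 0) :
    ∃ p ∈ m, ∀ q ∈ m, q ≤ p := by
  classical
  obtain ⟨p, hp, hmax⟩ := m.toFinset.exists_maximal (by simpa using h0)
  rw [Multiset.mem_toFinset] at hp
  refine ⟨p, hp, fun q hq => ?_⟩
  rcases hs.total (hm q hq) (hm p hp) with h | h
  · exact h
  · exact hmax (Multiset.mem_toFinset.2 hq) h

/-- A multiset of nonzero grid points supported on a chain is determined by its vector sum. -/
lemma eq_of_sum_gridVec_eq {k l : ℕ} {s s' : Set (ℕ × ℕ)} (hs : IsChain (· ≤ ·) s)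
    (hs' : IsChain (· ≤ ·) s') (hb : ∀ p ∈ s, p ≤ (k, l)) (hb' : ∀ p ∈ s', p ≤ (k, l))
    {m m' : Multiset (ℕ × ℕ)} (hm : ∀ p ∈ m, p ∈ s ∧ p ≠ (0, 0))
    (hm' : ∀ p ∈ m', p ∈ s' ∧ p ≠ (0, 0))
    (h : (m.map (gridVec k l)).sum = (m'.map (gridVec k l)).sum) : m = m' := by
  induction hn : m.card generalizing m m' with
  | zero =>
    obtain rfl := Multiset.card_eq_zero.1 hn
    refine (Multiset.eq_zero_of_forall_notMem fun p hp => (hm' p hp).2 ?_).symm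
    exact le_antisymm (le_of_sum_gridVec_eq h.symm hp (hb' p (hm' p hp).1) (by simp))
      ⟨Nat.zero_le _, Nat.zero_le _⟩
  | succ n ih =>
    have h0 : m ≠ 0 := by rintro rfl; simp at hn
    obtain ⟨p, hp, hpmax⟩ := hs.exists_multiset_greatest (fun q hq => (hm q hq).1) h0
    have h0' : m' ≠ 0 := by
      rintro rfl
      exact (hm p hp).2 (le_antisymm (le_of_sum_gridVec_eq h hp (hb p (hm p hp).1) (by simp))
        ⟨Nat.zero_le _, Nat.zero_le _⟩)
    obtain ⟨q, hq, hqmax⟩ := hs'.exists_multiset_greatest (fun q hq => (hm' q hq).1) h0'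
    obtain rfl : p = q := le_antisymm
      (le_of_sum_gridVec_eq h hp (hb p (hm p hp).1) hqmax)
      (le_of_sum_gridVec_eq h.symm hq (hb' q (hm' q hq).1) hpmax)
    obtain ⟨m, rfl⟩ := Multiset.exists_cons_of_mem hp
    obtain ⟨m', rfl⟩ := Multiset.exists_cons_of_mem hq
    rw [ih (fun q hq => hm q (Multiset.mem_cons_of_mem hq))
      (fun q hq => hm' q (Multiset.mem_cons_of_mem hq)) (by simpa using h) (by simpa using hn)]

lemma exists_multiset_of_mem_pathMonoid {k l : ℕ} {c : Fin (k + l + 1) → ℕ × ℕ}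
    {v : (Fin k → ℤ) × (Fin l → ℤ)} (hv : v ∈ pathMonoid k l c) :
    ∃ m : Multiset (ℕ × ℕ), (∀ p ∈ m, p ∈ Set.range c ∧ p ≠ (0, 0)) ∧
      (m.map (gridVec k l)).sum = v := by
  induction hv using AddSubmonoid.closure_induction with
  | mem x hx =>
    obtain ⟨t, ht, rfl⟩ := hx
    exact ⟨{c t}, by simpa using ht, by simp [gridVec]⟩
  | zero => exact ⟨0, by simp, by simp⟩
  | add x y _ _ hx hy =>
    obtain ⟨m, hm, rfl⟩ := hx
    obtain ⟨m', hm', rfl⟩ := hy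
    refine ⟨m + m', fun p hp => ?_, by simp⟩
    exact (Multiset.mem_add.1 hp).elim (hm p) (hm' p)

/-- Two submonoids of the staircase refinement meet along the face generated by their
common generators: `N_c ∩ N_{c'}` is the submonoid generated by the vectors `e_i ⊕ f_j`
over the common points `(i,j) ≠ (0,0)` of the two paths. -/
theorem stmt2 (k l : ℕ) (c c' : Fin (k + l + 1) → ℕ × ℕ)
    (hc : IsLatticePath k l c) (hc' : IsLatticePath k l c') :
    pathMonoid k l c ⊓ pathMonoid k l c' =
      AddSubmonoid.closure
        {v | ∃ ij : ℕ × ℕ, ij ∈ Set.range c ∧ ij ∈ Set.range c' ∧ ij ≠ (0, 0) ∧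
          v = (stdE k ij.1, stdE l ij.2)} := by
  refine le_antisymm ?_ (AddSubmonoid.closure_le.2 ?_)
  · rintro v ⟨hv, hv'⟩
    obtain ⟨m, hm, rfl⟩ := exists_multiset_of_mem_pathMonoid hv
    obtain ⟨m', hm', h⟩ := exists_multiset_of_mem_pathMonoid hv'
    obtain rfl : m = m' := eq_of_sum_gridVec_eq hc.monotone.isChain_range
      hc'.monotone.isChain_range (Set.forall_mem_range.2 hc.2.2.1)
      (Set.forall_mem_range.2 hc'.2.2.1) hm hm' h.symm
    refine AddSubmonoid.multiset_sum_mem _ _ fun v hv => ?_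
    obtain ⟨p, hp, rfl⟩ := Multiset.mem_map.1 hv
    exact AddSubmonoid.subset_closure ⟨p, (hm p hp).1, (hm' p hp).1, (hm p hp).2, rfl⟩
  · rintro _ ⟨_, ⟨t, rfl⟩, ⟨t', ht'⟩, h0, rfl⟩
    exact ⟨AddSubmonoid.subset_closure ⟨t, h0, rfl⟩,
      AddSubmonoid.subset_closure ⟨t', ht' ▸ h0, by rw [ht']⟩⟩
end

section
/- Let k, l ∈ ℕ, let p₀ = (0,0), p₁, …, p_{k+l} = (k,l) be a monotone lattice path in {0,…,k} × {0,…,l}, and let v_t = e_{i_t} ⊕ f_{j_t} for p_t = (i_t, j_t), t = 1, …, k+l, be the associated ℤ-basis of ℤ^k ⊕ ℤ^l (conventions e₀ = 0, f₀ = 0). Let v_1^*, …, v_{k+l}^* be the dual basis of Hom(ℤ^k ⊕ ℤ^l, ℤ), so v_s^*(v_t) = δ_{st}. Then for every t all the values v_t^*(e_i) (1 ≤ i ≤ k) and v_t^*(f_j) (1 ≤ j ≤ l) lie in {−1, 0, 1}; moreover, for each t, either v_t^*(e_i) ≥ 0 for all i and v_t^*(f_j) ≤ 0 for all j, or v_t^*(e_i)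 ≤ 0 for all i and v_t^*(f_j) ≥ 0 for all j. -/
/-- The vector `v_t = e_{i_t} ⊕ f_{j_t} ∈ ℤ^k ⊕ ℤ^l` associated to the point
`p_t = (i_t, j_t)` of a lattice path, `t = 1, …, k + l`. -/
def pathVec (k l : ℕ) (p : Fin (k + l + 1) → ℕ × ℕ) (t : Fin (k + l)) :
    (Fin k → ℤ) × (Fin l → ℤ) :=
  (stdE k (p t.succ).1, stdE l (p t.succ).2)

theorem stdE_zero (k : ℕ) : stdE k 0 = 0 := by
  funext q
  simp [stdE]

theorem stdE_succ (k : ℕ) (i : Fin k) : stdE k (i + 1) = Pi.single i 1 := by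
  funext q
  simp [stdE, Pi.single_apply, Fin.ext_iff]

/-- A sequence of naturals starting at `0` with increments at most `1` attains every value
below any of its terms. -/
theorem exists_eq_of_le_of_step (u : ℕ → ℕ) (h0 : u 0 = 0) (N : ℕ)
    (hu : ∀ n < N, u (n + 1) ≤ u n + 1) (i : ℕ) (hi : i ≤ u N) : ∃ n ≤ N, u n = i := by
  induction N with
  | zero => exact ⟨0, le_rfl, by omega⟩
  | succ N ih =>
    by_cases h : i ≤ u N
    · obtain ⟨n, hn, hni⟩ := ih (fun n hn => hu n (by omega)) h
      exact ⟨n, by omega, hni⟩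
    · exact ⟨N + 1, le_rfl, by have := hu N (by omega); omega⟩

theorem eq_zero_of_step (x y : ℕ → ℤ) (N T : ℕ) (hx : x 0 = 0) (hy : y 0 = 0)
    (hxy : ∀ n ≤ N, x n + y n = if n = T then 1 else 0)
    (hs : ∀ n < N, x (n + 1) = x n ∨ y (n + 1) = y n) (n : ℕ) (hn : n ≤ N) (hT : n < T) :
    x n = 0 ∧ y n = 0 := by
  induction n with
  | zero => exact ⟨hx, hy⟩
  | succ n ih =>
    have h1 := ih (by omega) (by omega)
    have h2 := hxy (n + 1) hn
    rw [if_neg (by omega)] at h2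
    rcases hs n (by omega) with h | h <;> omega

theorem sign_of_step_of_eq_zero (x y : ℕ → ℤ) (N T : ℕ)
    (hxy : ∀ n ≤ N, x n + y n = if n = T then 1 else 0)
    (hs : ∀ n < N, x (n + 1) = x n ∨ y (n + 1) = y n) (hxT : x T = 0)
    (n : ℕ) (hn : n ≤ N) (hT : T ≤ n) :
    (x n = 0 ∨ x n = -1) ∧ (y n = 0 ∨ y n = 1) := by
  induction n, hT using Nat.le_induction with
  | base =>
    have h := hxy T hn
    rw [if_pos rfl] at h
    omega
  | succ n hT ih =>
    have h1 := ih (by omega)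
    have h2 := hxy (n + 1) hn
    rw [if_neg (by omega)] at h2
    rcases hs n (by omega) with h | h <;> omega

/-- Two integer sequences starting at `0`, at most one of which changes at each step and whose
sum is the indicator of `T`, have opposite constant signs and values in `{-1, 0, 1}`. -/
theorem sign_of_step (x y : ℕ → ℤ) (N T : ℕ) (hx : x 0 = 0) (hy : y 0 = 0)
    (hxy : ∀ n ≤ N, x n + y n = if n = T then 1 else 0)
    (hs : ∀ n < N, x (n + 1) = x n ∨ y (n + 1) = y n) (hTN : T ≤ N) :
    (∀ n ≤ N, (x n = 0 ∨ x n = -1) ∧ (y n = 0 ∨ y n = 1)) ∨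
      (∀ n ≤ N, (y n = 0 ∨ y n = -1) ∧ (x n = 0 ∨ x n = 1)) := by
  have hz := eq_zero_of_step x y N T hx hy hxy hs
  have hT : x T = 0 ∨ y T = 0 := by
    rcases T with _ | T
    · exact Or.inl hx
    · have h1 := hz T (by omega) (by omega)
      rcases hs T (by omega) with h | h <;> omega
  rcases hT with h | h
  · left
    intro n hn
    rcases lt_or_ge n T with hnT | hnT
    · have := hz n hn hnT
      omega
    · exact sign_of_step_of_eq_zero x y N T hxy hs h n hn hnT
  · right
    intro n hn
    rcases lt_or_ge n T with hnT | hnT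
    · have := hz n hn hnT
      omega
    · exact sign_of_step_of_eq_zero y x N T (fun n hn => by rw [add_comm]; exact hxy n hn)
        (fun n hn => (hs n hn).symm) h n hn hnT

/-- The dual basis of the basis `v_1, …, v_{k+l}` of `ℤ^k ⊕ ℤ^l` associated to a monotone
lattice path takes only values in `{-1, 0, 1}` on the standard basis vectors `e_i` and
`f_j`; moreover, each dual functional is nonnegative on all the `e_i` and nonpositive on
all the `f_j`, or vice versa. -/
theorem stmt3 (k l : ℕ) (p : Fin (k + l + 1) → ℕ × ℕ) (hp : IsLatticePath k l p)
    (d : Fin (k + l) → ((Fin k → ℤ) × (Fin l → ℤ)) →ₗ[ℤ] ℤ)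
    (hd : ∀ s t, d s (pathVec k l p t) = if s = t then 1 else 0) :
    ∀ t : Fin (k + l),
      ((∀ i : Fin k, d t ((Pi.single i 1 : Fin k → ℤ), 0) ∈ ({-1, 0, 1} : Set ℤ)) ∧
       (∀ j : Fin l, d t (0, (Pi.single j 1 : Fin l → ℤ)) ∈ ({-1, 0, 1} : Set ℤ))) ∧
      (((∀ i : Fin k, 0 ≤ d t ((Pi.single i 1 : Fin k → ℤ), 0)) ∧
        (∀ j : Fin l, d t (0, (Pi.single j 1 : Fin l → ℤ)) ≤ 0)) ∨
       ((∀ i : Fin k, d t ((Pi.single i 1 : Fin k → ℤ), 0) ≤ 0) ∧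
        (∀ j : Fin l, 0 ≤ d t (0, (Pi.single j 1 : Fin l → ℤ))))) := by
  intro t
  obtain ⟨h0, hlast, -, hstep⟩ := hp
  obtain ⟨q, hq⟩ : ∃ q : ℕ → ℕ × ℕ, ∀ n : Fin (k + l + 1), q n = p n :=
    ⟨fun n => if h : n < k + l + 1 then p ⟨n, h⟩ else 0, fun n => by simp only [n.isLt, dite_true]⟩
  have hq0 : q 0 = (0, 0) := by simpa [h0] using hq 0
  have hqN : q (k + l) = (k, l) := by simpa [hlast] using hq (Fin.last (k + l))
  have hqs : ∀ n < k + l, q (n + 1) = ((q n).1 + 1, (q n).2) ∨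
      q (n + 1) = ((q n).1, (q n).2 + 1) := by
    intro n hn
    have h1 := hq (Fin.castSucc ⟨n, hn⟩)
    have h2 := hq (Fin.succ ⟨n, hn⟩)
    have h3 := hstep ⟨n, hn⟩
    rw [← h1, ← h2] at h3
    exact h3
  have key := sign_of_step (fun n => d t (stdE k (q n).1, 0)) (fun n => d t (0, stdE l (q n).2))
    (k + l) (t + 1)
    (by simp [hq0, stdE_zero, ← Prod.zero_eq_mk])
    (by simp [hq0, stdE_zero, ← Prod.zero_eq_mk])
    (by
      intro n hn
      simp only [← map_add, Prod.mk_add_mk, add_zero, zero_add]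
      rcases n with _ | n
      · simp [hq0, stdE_zero, ← Prod.zero_eq_mk]
      · have h1 := hd t ⟨n, hn⟩
        rw [pathVec, ← hq] at h1
        simp only [Fin.val_succ] at h1
        rw [h1]
        simp [Fin.ext_iff, eq_comm])
    (by
      intro n hn
      rcases hqs n hn with h | h
      · right; simp only [h]
      · left; simp only [h])
    t.isLt
  have hX : ∀ i : Fin k, ∃ n ≤ k + l, (q n).1 = i + 1 := fun i =>
    exists_eq_of_le_of_step (fun n => (q n).1) (by simp [hq0]) (k + l)
      (fun n hn => by rcases hqs n hn with h | h <;> simp [h]) _ (by simp only [hqN]; omega)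
  have hY : ∀ j : Fin l, ∃ n ≤ k + l, (q n).2 = j + 1 := fun j =>
    exists_eq_of_le_of_step (fun n => (q n).2) (by simp [hq0]) (k + l)
      (fun n hn => by rcases hqs n hn with h | h <;> simp [h]) _ (by simp only [hqN]; omega)
  simp only [← stdE_succ, Set.mem_insert_iff, Set.mem_singleton_iff]
  rcases key with key | key
  · have hA : ∀ i : Fin k, d t (stdE k (i + 1), 0) = 0 ∨ d t (stdE k (i + 1), 0) = -1 := by
      intro i
      obtain ⟨n, hn, h⟩ := hX i
      simpa only [h] using (key n hn).1
    have hB : ∀ j : Fin l, d t (0, stdE l (j + 1)) = 0 ∨ d t (0, stdE l (j + 1)) = 1 := by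
      intro j
      obtain ⟨n, hn, h⟩ := hY j
      simpa only [h] using (key n hn).2
    refine ⟨⟨fun i => ?_, fun j => ?_⟩, Or.inr ⟨fun i => ?_, fun j => ?_⟩⟩
    · have := hA i; omega
    · have := hB j; omega
    · have := hA i; omega
    · have := hB j; omega
  · have hA : ∀ i : Fin k, d t (stdE k (i + 1), 0) = 0 ∨ d t (stdE k (i + 1), 0) = 1 := by
      intro i
      obtain ⟨n, hn, h⟩ := hX i
      simpa only [h] using (key n hn).2
    have hB : ∀ j : Fin l, d t (0, stdE l (j + 1)) = 0 ∨ d t (0, stdE l (j + 1)) = -1 := by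
      intro j
      obtain ⟨n, hn, h⟩ := hY j
      simpa only [h] using (key n hn).1
    refine ⟨⟨fun i => ?_, fun j => ?_⟩, Or.inl ⟨fun i => ?_, fun j => ?_⟩⟩
    · have := hA i; omega
    · have := hB j; omega
    · have := hA i; omega
    · have := hB j; omega
end

section
/- Let n, r ∈ ℕ with r ≥ 1 and let σ_1, …, σ_r : ℤ^n → ℤ be ℤ-linear functionals such that ℕ^n ∩ ⋂_{i=1}^r ker σ_i is a face of ℕ^n, i.e., equals {x ∈ ℕ^n : x_j = 0 for all j ∉ S} for some subset S ⊆ {1,…,n}. Then there exist ℤ-linear functionals τ_1, …, τ_r on ℤ^n, each a ℤ-linear combination of σ_1, …, σ_r, such that: (i) every τ_i is determinate on ℕ^n, meaning τ_i(e_j) ≥ 0 for all standard basis vectors e_j or τ_i(e_j) ≤ 0 for all e_j; and (ii) τ_1, …, τ_r span the same ℚ-linear subspace of Hom(ℚ^n, ℚ) as σ_1, …, σ_r (equivalently, each σ_i is a ℚ-linear combination of τ_1, …, τ_r). -/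
open scoped BigOperators

lemma exists_two_le_forall_lt_mul {ι : Type*} (s : Finset ι) (p q : ι → ℤ)
    (hp : ∀ i ∈ s, 0 < p i) : ∃ N : ℤ, 2 ≤ N ∧ ∀ i ∈ s, q i < N * p i := by
  refine ⟨∑ i ∈ s, |q i| + 2, ?_, fun i hi => ?_⟩
  · have := Finset.sum_nonneg (s := s) (f := fun i => |q i|) fun i _ => abs_nonneg _
    linarith
  · have h := Finset.single_le_sum (f := fun i => |q i|) (fun i _ => abs_nonneg _) hi
    have h' := le_abs_self (q i)
    have := hp i hi
    have h0 := abs_nonneg (q i)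
    nlinarith

/-- **Gordan's theorem** over `ℤ`: a finite family of integer vectors either satisfies a nontrivial
relation with nonnegative coefficients, or lies in an open half-space. -/
lemma gordan_int {ι ρ : Type*} [Fintype ρ] (s : Finset ι) (v : ι → ρ → ℤ) :
    (∃ x : ι → ℤ, (∀ i ∈ s, 0 ≤ x i) ∧ (∃ i ∈ s, 0 < x i) ∧ ∑ i ∈ s, x i • v i = 0) ∨
      ∃ c : ρ → ℤ, ∀ i ∈ s, 0 < c ⬝ᵥ v i := by
  classical
  induction s using Finset.induction_on generalizing v with
  | empty => exact .inr ⟨0, by simp⟩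
  | insert a s ha ih =>
    have extend (x : ι → ℤ) (t : ℤ) : ∑ i ∈ insert a s, Function.update x a t i • v i =
        t • v a + ∑ i ∈ s, x i • v i := by
      rw [Finset.sum_insert ha, Function.update_self]
      congr 1
      refine Finset.sum_congr rfl fun i hi => ?_
      rw [Function.update_of_ne (ne_of_mem_of_not_mem hi ha)]
    have of_relation (x : ι → ℤ) (t : ℤ) (hx : ∀ i ∈ s, 0 ≤ x i) (ht : 0 ≤ t)
        (hpos : 0 < t ∨ ∃ i ∈ s, 0 < x i) (hsum : t • v a + ∑ i ∈ s, x i • v i = 0) :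
        ∃ x : ι → ℤ, (∀ i ∈ insert a s, 0 ≤ x i) ∧ (∃ i ∈ insert a s, 0 < x i) ∧
          ∑ i ∈ insert a s, x i • v i = 0 := by
      refine ⟨Function.update x a t, fun i hi => ?_, ?_, by rw [extend, hsum]⟩
      · obtain rfl | hi := Finset.mem_insert.1 hi
        · simpa using ht
        · rw [Function.update_of_ne (ne_of_mem_of_not_mem hi ha)]
          exact hx i hi
      · obtain ht | ⟨i, hi, hxi⟩ := hpos
        · exact ⟨a, by simp, by simpa using ht⟩
        · refine ⟨i, by simp [hi], ?_⟩
          rwa [Function.update_of_ne (ne_of_mem_of_not_mem hi ha)]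
    obtain ⟨x, hx, hpos, hsum⟩ | ⟨f, hf⟩ := ih v
    · exact .inl (of_relation x 0 hx le_rfl (.inr hpos) (by simpa using hsum))
    obtain hfa | hfa | hfa := lt_trichotomy (f ⬝ᵥ v a) 0
    · obtain ⟨x, hx, ⟨k, hk, hxk⟩, hsum⟩ | ⟨g, hg⟩ :=
        ih fun i => (-(f ⬝ᵥ v a)) • v i + (f ⬝ᵥ v i) • v a
      · refine .inl (of_relation (fun i => x i * -(f ⬝ᵥ v a)) (∑ i ∈ s, x i * (f ⬝ᵥ v i))
          (fun i hi => mul_nonneg (hx i hi) (by linarith))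
          (Finset.sum_nonneg fun i hi => mul_nonneg (hx i hi) (hf i hi).le)
          (.inr ⟨k, hk, mul_pos hxk (by linarith)⟩) ?_)
        rw [Finset.sum_smul, ← Finset.sum_add_distrib, ← hsum]
        refine Finset.sum_congr rfl fun i _ => ?_
        rw [smul_add, smul_smul, smul_smul, add_comm]
      · simp only [dotProduct_add, dotProduct_smul, smul_eq_mul] at hg
        obtain ⟨N, -, hN⟩ := exists_two_le_forall_lt_mul s _ (fun i => f ⬝ᵥ v i) hg
        refine .inr ⟨N • ((-(f ⬝ᵥ v a)) • g + (g ⬝ᵥ v a) • f) - f, fun i hi => ?_⟩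
        simp only [sub_dotProduct, add_dotProduct, smul_dotProduct, smul_eq_mul]
        obtain rfl | hi := Finset.mem_insert.1 hi
        · linarith
        · linarith [hN i hi]
    · by_cases hva : v a = 0
      · exact .inl (of_relation 0 1 (by simp) zero_le_one (.inl one_pos) (by simp [hva]))
      · have hpos : 0 < v a ⬝ᵥ v a :=
          lt_of_le_of_ne (Finset.sum_nonneg fun i _ => mul_self_nonneg _)
            fun h => hva (dotProduct_self_eq_zero.1 h.symm)
        obtain ⟨N, -, hN⟩ := exists_two_le_forall_lt_mul s _ (fun i => -(v a ⬝ᵥ v i)) hf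
        refine .inr ⟨N • f + v a, fun i hi => ?_⟩
        simp only [add_dotProduct, smul_dotProduct, smul_eq_mul]
        obtain rfl | hi := Finset.mem_insert.1 hi
        · simpa [hfa] using hpos
        · linarith [hN i hi]
    · refine .inr ⟨f, fun i hi => ?_⟩
      obtain rfl | hi := Finset.mem_insert.1 hi
      exacts [hfa, hf i hi]

/-- If integer functionals vanish on `e_j` for `j ∉ s` and have no common nonnegative zero
charging `s`, some integer combination of them is positive on `e_j` for all `j ∈ s`. -/
lemma exists_combination_pos {n r : ℕ} (σ : Fin r → ((Fin n → ℤ) →ₗ[ℤ] ℤ)) (s : Finset (Fin n))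
    (h : ∀ x : Fin n → ℤ, (∀ j, 0 ≤ x j) → (∀ i, σ i x = 0) → ∀ j ∈ s, x j = 0) :
    ∃ c : Fin r → ℤ, ∀ j ∈ s, 0 < (∑ i, c i • σ i) (Pi.single j 1) := by
  obtain ⟨x, hx, ⟨k, hk, hxk⟩, hsum⟩ | ⟨c, hc⟩ :=
    gordan_int s fun j i => σ i (Pi.single j 1)
  · have hk0 := h (∑ j ∈ s, x j • Pi.single j 1) (fun j => ?_) (fun i => ?_) k hk
    · simp [Finset.sum_apply, Pi.single_apply, hk] at hk0
      omega
    · simp only [Finset.sum_apply, Pi.smul_apply, Pi.single_apply, smul_eq_mul]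
      exact Finset.sum_nonneg fun l hl => mul_nonneg (hx l hl) (by split_ifs <;> simp)
    · simpa only [map_sum, map_smul, Finset.sum_apply, Pi.smul_apply, Pi.zero_apply] using
      congrFun hsum i
  · refine ⟨c, fun j hj => ?_⟩
    simpa [dotProduct, LinearMap.sum_apply] using hc j hj

/-- If `ℤ`-linear functionals `σ_1, …, σ_r` on `ℤ^n` are such that
`ℕ^n ∩ ⋂ᵢ ker σᵢ` is a face of `ℕ^n`, then they may be replaced by `ℤ`-linear
combinations `τ_1, …, τ_r` of themselves, each determinate on `ℕ^n` (nonnegative on all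
standard basis vectors or nonpositive on all of them), spanning the same `ℚ`-linear
subspace of the dual (equivalently, each `σᵢ` is a `ℚ`-linear combination of the `τ`'s,
i.e. some nonzero integer multiple of `σᵢ` is a `ℤ`-linear combination of the `τ`'s). -/
theorem stmt8 (n r : ℕ) (hr : 1 ≤ r) (σ : Fin r → ((Fin n → ℤ) →ₗ[ℤ] ℤ))
    (hface : ∃ S : Set (Fin n),
      {x : Fin n → ℤ | (∀ j, 0 ≤ x j) ∧ ∀ i, σ i x = 0} =
        {x : Fin n → ℤ | (∀ j, 0 ≤ x j) ∧ ∀ j ∉ S, x j = 0}) :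
    ∃ τ : Fin r → ((Fin n → ℤ) →ₗ[ℤ] ℤ),
      -- each `τᵢ` is a `ℤ`-linear combination of the `σ`'s
      (∀ i, ∃ c : Fin r → ℤ, τ i = ∑ j, c j • σ j) ∧
      -- each `τᵢ` is determinate on `ℕ^n`
      (∀ i, (∀ j, 0 ≤ τ i (Pi.single j 1)) ∨ (∀ j, τ i (Pi.single j 1) ≤ 0)) ∧
      -- the `τ`'s span the same `ℚ`-subspace: each `σᵢ` is a `ℚ`-linear combination
      (∀ i, ∃ N : ℤ, N ≠ 0 ∧ ∃ c : Fin r → ℤ, N • σ i = ∑ j, c j • τ j) := by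
  classical
  obtain ⟨S, hS⟩ := hface
  have hS (x : Fin n → ℤ) (hx : ∀ j, 0 ≤ x j) : (∀ i, σ i x = 0) ↔ ∀ j ∉ S, x j = 0 := by
    simpa [hx] using Set.ext_iff.1 hS x
  have hvanish (j) (hj : j ∈ S) (i) : σ i (Pi.single j 1) = 0 := by
    refine (hS (Pi.single j 1) (fun k => ?_)).2 (fun k hk => ?_) i
    · rw [Pi.single_apply]
      split_ifs <;> simp
    · exact Pi.single_eq_of_ne (ne_of_mem_of_not_mem hj hk).symm _
  obtain ⟨c, hc⟩ := exists_combination_pos σ (Finset.univ.filter (· ∉ S))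
    fun x hx hσ j hj => (hS x hx).1 hσ j (Finset.mem_filter.1 hj).2
  set τ := ∑ i, c i • σ i with hτ
  obtain ⟨N, hN2, hN⟩ := exists_two_le_forall_lt_mul
    (Finset.univ.filter (· ∉ S) ×ˢ (Finset.univ : Finset (Fin r)))
    (fun p => τ (Pi.single p.1 1)) (fun p => -σ p.2 (Pi.single p.1 1))
    fun p hp => hc p.1 (Finset.mem_product.1 hp).1
  have hcomb : ∑ j, c j • (σ j + N • τ) = (1 + N * ∑ j, c j) • τ := by
    simp only [smul_add, Finset.sum_add_distrib, ← Finset.sum_smul, ← hτ]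
    module
  refine ⟨fun i => σ i + N • τ, fun i => ⟨Pi.single i 1 + N • c, ?_⟩, fun i => .inl fun j => ?_,
    fun i => ⟨1 + N * ∑ j, c j, fun h => ?_, Pi.single i (1 + N * ∑ j, c j) - N • c, ?_⟩⟩
  · simp [add_smul, Finset.sum_add_distrib, mul_smul, ← Finset.smul_sum, ← hτ, Pi.single_apply,
      ite_smul]
  · by_cases hj : j ∈ S
    · simp [hτ, LinearMap.sum_apply, hvanish j hj]
    · have := hN (j, i) (by simp [hj])
      simp only [LinearMap.add_apply, LinearMap.smul_apply, smul_eq_mul] at this ⊢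
      linarith
  · have : N ∣ 1 := ⟨-∑ j, c j, by linarith⟩
    linarith [Int.le_of_dvd one_pos this]
  · simp only [Pi.sub_apply, Pi.smul_apply, smul_eq_mul, sub_smul, Finset.sum_sub_distrib,
      mul_smul, ← Finset.smul_sum, hcomb]
    simp only [Pi.single_apply, ite_smul, zero_smul, Finset.sum_ite_eq', Finset.mem_univ,
      if_true]
    module
end

section
/- Let k ∈ ℕ with k ≥ 1 and let a ∈ ℤ^k. Define f : (0,∞)^k → (0,∞) by f(x) = ∏_{i=1}^k x_i^{a_i}. Then f extends to a continuous map [0,∞)^k → [0,∞] (with values in the extended nonnegative reals with their order topology) if and only if a_i ≥ 0 for all i, or a_i ≤ 0 for all i. Moreover, if a_i ≥ 0 for all i, the extension is finite-valued and vanishes exactly at those x ∈ [0,∞)^k with x_i = 0 for some i with a_i > 0; and if a_i ≤ 0 for all i, the extension takes the value +∞ exactly at those x with x_i = 0 for some i with a_i < 0. -/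
open scoped NNReal ENNReal BigOperators

lemma dense_Ioi_zero : Dense (Set.Ioi (0 : ℝ≥0)) := by
  rw [dense_iff_closure_eq, closure_Ioi, ← bot_eq_zero, Set.Ici_bot]

/-- Points with all coordinates positive are dense in the orthant `[0,∞)^ι`. -/
lemma dense_setOf_forall_pos {ι : Type*} : Dense {x : ι → ℝ≥0 | ∀ i, 0 < x i} := by
  convert dense_pi (Set.univ : Set ι) (fun _ _ => dense_Ioi_zero) using 1
  ext x
  simp

lemma ofReal_prod_zpow {ι : Type*} [Fintype ι] (x : ι → ℝ≥0) (a : ι → ℤ) :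
    ENNReal.ofReal (∏ i, (x i : ℝ) ^ a i) = ((∏ i, x i ^ a i : ℝ≥0) : ℝ≥0∞) := by
  rw [← ENNReal.ofReal_coe_nnreal]
  push_cast
  rfl

lemma continuous_coe_prod_pow {ι : Type*} [Fintype ι] (b : ι → ℕ) :
    Continuous fun x : ι → ℝ≥0 => ((∏ i, x i ^ b i : ℝ≥0) : ℝ≥0∞) :=
  ENNReal.continuous_coe.comp (by fun_prop)

lemma ofReal_prod_zpow_of_nonneg {ι : Type*} [Fintype ι] {a : ι → ℤ} (ha : ∀ i, 0 ≤ a i)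
    (x : ι → ℝ≥0) :
    ENNReal.ofReal (∏ i, (x i : ℝ) ^ a i) = ((∏ i, x i ^ (a i).toNat : ℝ≥0) : ℝ≥0∞) := by
  rw [ofReal_prod_zpow]
  congr 1
  refine Finset.prod_congr rfl fun i _ => ?_
  rw [← zpow_natCast, Int.toNat_of_nonneg (ha i)]

lemma ofReal_prod_zpow_of_nonpos {ι : Type*} [Fintype ι] {a : ι → ℤ} (ha : ∀ i, a i ≤ 0)
    {x : ι → ℝ≥0} (hx : ∀ i, 0 < x i) :
    ENNReal.ofReal (∏ i, (x i : ℝ) ^ a i) =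
      ((∏ i, x i ^ (-a i).toNat : ℝ≥0) : ℝ≥0∞)⁻¹ := by
  have hne : ∏ i, x i ^ (-a i).toNat ≠ 0 :=
    Finset.prod_ne_zero_iff.2 fun i _ => pow_ne_zero _ (hx i).ne'
  rw [ofReal_prod_zpow, ← ENNReal.coe_inv hne, ← Finset.prod_inv_distrib]
  congr 1
  refine Finset.prod_congr rfl fun i _ => ?_
  rw [← zpow_natCast, Int.toNat_of_nonneg (neg_nonneg.2 (ha i)), zpow_neg, inv_inv]

lemma prod_pow_toNat_eq_zero_iff {ι : Type*} [Fintype ι] (b : ι → ℤ) (x : ι → ℝ≥0) :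
    ∏ i, x i ^ (b i).toNat = 0 ↔ ∃ i, x i = 0 ∧ 0 < b i := by
  simp [Finset.prod_eq_zero_iff, pow_eq_zero_iff']

/-- A continuous extension of a monomial forbids exponents of opposite signs: along the curves
`xᵢ = c t^n`, `xⱼ = t^m` with `m = aᵢ` and `n = -aⱼ`, the monomial is constantly `c ^ m`. -/
lemma not_pos_and_neg_of_continuous_extension {ι : Type*} [Fintype ι] {a : ι → ℤ}
    {F : (ι → ℝ≥0) → ℝ≥0∞} (hF : Continuous F)
    (hFa : ∀ x : ι → ℝ≥0, (∀ i, 0 < x i) → F x = ENNReal.ofReal (∏ i, (x i : ℝ) ^ a i))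
    {i j : ι} (hi : 0 < a i) (hj : a j < 0) : False := by
  classical
  obtain ⟨m, hm⟩ := Int.eq_ofNat_of_zero_le hi.le
  obtain ⟨n, hn⟩ := Int.eq_ofNat_of_zero_le (neg_nonneg.2 hj.le)
  have hm0 : m ≠ 0 := by omega
  have hn0 : n ≠ 0 := by omega
  have hij : j ≠ i := by rintro rfl; omega
  let γ : ℝ≥0 → ℝ≥0 → ι → ℝ≥0 := fun c t =>
    Function.update (Function.update 1 i (c * t ^ n)) j (t ^ m)
  have hγ : ∀ c, Continuous (γ c) := fun c =>
    (continuous_const.update i (by fun_prop)).update j (by fun_prop)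
  have hpos : ∀ c t, 0 < c → 0 < t → F (γ c t) = ((c ^ m : ℝ≥0) : ℝ≥0∞) := by
    intro c t hc ht
    rw [hFa, ofReal_prod_zpow, Fintype.prod_eq_mul i j hij.symm]
    · have haj : a j = -(n : ℤ) := by omega
      simp only [γ, Function.update_self, Function.update_of_ne hij.symm, hm, haj]
      congr 1
      rw [zpow_neg, zpow_natCast, zpow_natCast, mul_pow, ← pow_mul, ← pow_mul, mul_comm n m,
        mul_assoc, mul_inv_cancel₀ (pow_ne_zero _ ht.ne'), mul_one]
    · rintro l ⟨hli, hlj⟩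
      simp [γ, hli, hlj]
    · intro l
      by_cases hlj : l = j
      · subst hlj; simp [γ, pow_pos ht]
      · by_cases hli : l = i
        · subst hli; simp [γ, hlj, hc, pow_pos ht]
        · simp [γ, hlj, hli]
  have hzero : ∀ c, 0 < c → F (γ c 0) = ((c ^ m : ℝ≥0) : ℝ≥0∞) := fun c hc =>
    congrFun (Continuous.ext_on dense_Ioi_zero (hF.comp (hγ c)) continuous_const
      fun t ht => hpos c t hc ht) 0
  have hγ0 : γ 1 0 = γ 2 0 := by simp [γ, hn0]
  have h := (hzero 1 one_pos).symm.trans ((congrArg F hγ0).trans (hzero 2 two_pos))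
  rw [ENNReal.coe_inj, one_pow] at h
  exact (one_lt_pow₀ (one_lt_two : (1 : ℝ≥0) < 2) hm0).ne h

/-- The monomial `f(x) = ∏ᵢ xᵢ^{aᵢ}` (integer exponents) on `(0,∞)^k` extends to a
continuous map `[0,∞)^k → [0,∞]` if and only if the exponents `aᵢ` are all nonnegative
or all nonpositive.  Moreover, if all `aᵢ ≥ 0` the extension is finite-valued and
vanishes exactly at points having some coordinate `xᵢ = 0` with `aᵢ > 0`, while if all
`aᵢ ≤ 0` the extension takes the value `+∞` exactly at points having some coordinate
`xᵢ = 0` with `aᵢ < 0`. -/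
theorem stmt10 (k : ℕ) (hk : 1 ≤ k) (a : Fin k → ℤ) :
    ((∃ F : (Fin k → ℝ≥0) → ℝ≥0∞, Continuous F ∧
        ∀ x : Fin k → ℝ≥0, (∀ i, 0 < x i) →
          F x = ENNReal.ofReal (∏ i, (x i : ℝ) ^ (a i))) ↔
      ((∀ i, 0 ≤ a i) ∨ (∀ i, a i ≤ 0))) ∧
    (∀ F : (Fin k → ℝ≥0) → ℝ≥0∞, Continuous F →
      (∀ x : Fin k → ℝ≥0, (∀ i, 0 < x i) →
        F x = ENNReal.ofReal (∏ i, (x i : ℝ) ^ (a i))) →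
      ((∀ i, 0 ≤ a i) →
        ∀ x : Fin k → ℝ≥0, F x ≠ ⊤ ∧ (F x = 0 ↔ ∃ i, x i = 0 ∧ 0 < a i)) ∧
      ((∀ i, a i ≤ 0) →
        ∀ x : Fin k → ℝ≥0, (F x = ⊤ ↔ ∃ i, x i = 0 ∧ a i < 0))) := by
  refine ⟨⟨?_, ?_⟩, fun F hF hFa => ⟨fun ha x => ?_, fun ha x => ?_⟩⟩
  · rintro ⟨F, hF, hFa⟩
    by_contra! h
    obtain ⟨⟨j, hj⟩, i, hi⟩ := h
    exact not_pos_and_neg_of_continuous_extension hF hFa hi hj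
  · rintro (ha | ha)
    · exact ⟨_, continuous_coe_prod_pow fun i => (a i).toNat,
        fun x _ => (ofReal_prod_zpow_of_nonneg ha x).symm⟩
    · exact ⟨_, (continuous_coe_prod_pow fun i => (-a i).toNat).inv,
        fun x hx => (ofReal_prod_zpow_of_nonpos ha hx).symm⟩
  · have hFx : F x = _ := congrFun (Continuous.ext_on dense_setOf_forall_pos hF
      (continuous_coe_prod_pow fun i => (a i).toNat)
      fun y hy => (hFa y hy).trans (ofReal_prod_zpow_of_nonneg ha y)) x
    rw [hFx, ENNReal.coe_eq_zero, prod_pow_toNat_eq_zero_iff]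
    exact ⟨ENNReal.coe_ne_top, Iff.rfl⟩
  · have hFx : F x = _ := congrFun (Continuous.ext_on dense_setOf_forall_pos hF
      (continuous_coe_prod_pow fun i => (-a i).toNat).inv
      fun y hy => (hFa y hy).trans (ofReal_prod_zpow_of_nonpos ha hy)) x
    rw [hFx, Pi.inv_apply, ENNReal.inv_eq_top, ENNReal.coe_eq_zero,
      prod_pow_toNat_eq_zero_iff fun i => -a i]
    simp only [Left.neg_pos_iff]
end
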